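/- For every t ∈ [0,1] and every even integer s ≥ 2, γ_{s,2}(t) := ℙ(D_s(t) ∩ M_2(t)) = −(e^{−t} − 1 + t) e^{−t} [ (1/2) ∑_{i=3}^{s} (−2t)^i/i! + (1−t) ∑_{i=0}^{s/2−2} t^{2i+3}/(2i+3)! ], where the second sum is empty when s = 2. -/

import Mathlib

open MeasureTheory Set

/-- `P` is the infinite product over `ℤ` of the uniform probability measure on `[0,1]`,
characterized by its values on cylinder sets. -/
def IsUniformProduct (P : Measure (ℤ → ℝ)) : Prop :=
  ∀ (F : Finset ℤ) (A : ℤ → Set ℝ), (∀ i ∈ F, MeasurableSet (A i)) →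
    P {T | ∀ i ∈ F, T i ∈ A i} = ∏ i ∈ F, (volume.restrict (Icc (0 : ℝ) 1)) (A i)

/-- The event `G_{jk}^s(t)`. -/
def G (t : ℝ) (s : ℤ) (j k : ℕ) : Set (ℤ → ℝ) :=
  {T | T s < t ∧
    (∀ i : ℕ, i < 2 * j → T (s - i - 1) < T (s - i)) ∧
    T (s - 2 * j) < T (s - 2 * j - 1) ∧
    (∀ i : ℕ, i < 2 * k → T (s + i + 1) < T (s + i)) ∧
    T (s + 2 * k) < T (s + 2 * k + 1)}

/-- The event that site `s` is occupied by time `t`. -/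
def O (t : ℝ) (s : ℤ) : Set (ℤ → ℝ) := ⋃ (j : ℕ) (k : ℕ), G t s j k

/-- The event that sites `-1` and `0` are vacant and site `s` is occupied at time `t`. -/
def D (t : ℝ) (s : ℤ) : Set (ℤ → ℝ) := (O t (-1))ᶜ ∩ (O t 0)ᶜ ∩ O t s

def M1 (t : ℝ) : Set (ℤ → ℝ) := {T | t < T (-1) ∧ t < T 0}
def M2 (t : ℝ) : Set (ℤ → ℝ) := {T | T (-1) < t ∧ T 0 < t}
def M3 (t : ℝ) : Set (ℤ → ℝ) := {T | T (-1) < t ∧ t < T 0}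
def M4 (t : ℝ) : Set (ℤ → ℝ) := {T | T 0 < t ∧ t < T (-1)}


/-- A set of configurations that is determined by the coordinates in `I`. -/
def Dep (S : Set (ℤ → ℝ)) (I : Set ℤ) : Prop :=
  ∀ T T' : ℤ → ℝ, (∀ i ∈ I, T i = T' i) → (T ∈ S ↔ T' ∈ S)

noncomputable def lam : Measure ℝ := volume.restrict (Icc (0 : ℝ) 1)

instance : IsProbabilityMeasure lam := ⟨by simp [lam]⟩

lemma unif_eq {P : Measure (ℤ → ℝ)} (hP : IsUniformProduct P) :
    P = Measure.infinitePi (fun _ : ℤ => lam) := by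
  refine Measure.eq_infinitePi _ (fun F A hA => ?_)
  have := hP F A (fun i _ => hA i)
  simpa [Set.pi, lam] using this

lemma unif_prob {P : Measure (ℤ → ℝ)} (hP : IsUniformProduct P) : IsProbabilityMeasure P := by
  rw [unif_eq hP]; infer_instance

lemma unif_eval {P : Measure (ℤ → ℝ)} (hP : IsUniformProduct P) (a : ℤ) :
    P.map (fun T => T a) = lam := by
  rw [unif_eq hP]
  exact (measurePreserving_eval_infinitePi (fun _ : ℤ => lam) a).map_eq

/-- Reindexing invariance. -/
lemma unif_reindex {P : Measure (ℤ → ℝ)} (hP : IsUniformProduct P) (σ : ℤ ≃ ℤ) :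
    P.map (fun T i => T (σ i)) = P := by
  conv_rhs => rw [unif_eq hP]
  refine Measure.eq_infinitePi _ (fun F A hA => ?_)
  rw [Measure.map_apply (by fun_prop) (MeasurableSet.pi F.countable_toSet (fun i _ => hA i))]
  have := hP (F.map σ.toEmbedding) (fun i => A (σ.symm i)) (fun i _ => hA _)
  simp only [Finset.mem_map_equiv, Finset.prod_map, Equiv.toEmbedding_apply,
    Equiv.symm_apply_apply] at this
  rw [lam, ← this]
  congr 1
  ext T
  simp only [Set.mem_preimage, Set.mem_pi, Finset.mem_coe, Set.mem_ofPred_eq]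
  constructor
  · intro h i hi
    simpa using h _ hi
  · intro h i hi
    simpa using h (σ i) (by simpa using hi)

open Classical in
/-- Take the coordinates in `I` from the first configuration, the others from the second one. -/
noncomputable def glue (I : Set ℤ) (p : (ℤ → ℝ) × (ℤ → ℝ)) : ℤ → ℝ :=
  fun i => if i ∈ I then p.1 i else p.2 i

lemma glue_meas (I : Set ℤ) : Measurable (glue I) := by
  classical
  refine measurable_pi_lambda _ (fun i => ?_)
  unfold glue
  split_ifs <;> fun_prop

lemma unif_glue {P : Measure (ℤ → ℝ)} (hP : IsUniformProduct P) (I : Set ℤ) :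
    (P.prod P).map (glue I) = P := by
  classical
  have := unif_prob hP
  conv_rhs => rw [unif_eq hP]
  refine Measure.eq_infinitePi _ (fun F A hA => ?_)
  rw [Measure.map_apply (glue_meas I) (MeasurableSet.pi F.countable_toSet (fun i _ => hA i))]
  have h1 := hP (F.filter (· ∈ I)) A (fun i _ => hA _)
  have h2 := hP (F.filter (· ∉ I)) A (fun i _ => hA _)
  have : glue I ⁻¹' (Set.pi F A) =
      {T : ℤ → ℝ | ∀ i ∈ F.filter (· ∈ I), T i ∈ A i} ×ˢ
      {T : ℤ → ℝ | ∀ i ∈ F.filter (· ∉ I), T i ∈ A i} := by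
    ext p
    simp only [Set.mem_preimage, Set.mem_pi, Finset.mem_coe, Set.mem_prod, Set.mem_ofPred_eq, glue,
      Finset.mem_filter]
    constructor
    · intro h
      refine ⟨fun i hi => ?_, fun i hi => ?_⟩
      · simpa [hi.2] using h i hi.1
      · simpa [hi.2] using h i hi.1
    · rintro ⟨h1, h2⟩ i hi
      by_cases hI : i ∈ I
      · simpa [hI] using h1 i ⟨hi, hI⟩
      · simpa [hI] using h2 i ⟨hi, hI⟩
  rw [this, Measure.prod_prod, h1, h2, Finset.prod_filter_mul_prod_filter_not]
  rfl

/-- Events determined by disjoint sets of coordinates are independent. -/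
lemma unif_indep {P : Measure (ℤ → ℝ)} (hP : IsUniformProduct P) {S S' : Set (ℤ → ℝ)}
    (hS : MeasurableSet S) (hS' : MeasurableSet S') (I : Set ℤ)
    (h : Dep S I) (h' : Dep S' Iᶜ) :
    P.real (S ∩ S') = P.real S * P.real S' := by
  classical
  have := unif_prob hP
  have : P (S ∩ S') = P S * P S' := by
    conv_lhs => rw [← unif_glue hP I]
    rw [Measure.map_apply (glue_meas I) (hS.inter hS'), ← Measure.prod_prod]
    congr 1
    ext p
    simp only [Set.mem_preimage, Set.mem_inter_iff, Set.mem_prod]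
    refine and_congr (h _ _ ?_) (h' _ _ ?_)
    · intro i hi; simp [glue, hi]
    · intro i hi; simp [glue, show i ∉ I from hi]
  simp [Measure.real, this]

/-- Integrating out the coordinate `a`. -/
lemma unif_integrate {P : Measure (ℤ → ℝ)} (hP : IsUniformProduct P) {S : Set (ℤ → ℝ)}
    (hS : MeasurableSet S) {a b : ℤ} (hab : b ≠ a) (h : Dep S {a}ᶜ) {y : ℝ} (hy : y ∈ Icc (0:ℝ) 1) :
    P.real (S ∩ {T | T b < T a ∧ T a < y}) = ∫ x in (0:ℝ)..y, P.real (S ∩ {T | T b < x}) := by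
  classical
  have := unif_prob hP
  have hm : MeasurableSet {p : ℝ × (ℤ → ℝ) | p.2 ∈ S ∧ p.2 b < p.1 ∧ p.1 < y} := by
    have h1 : MeasurableSet {p : ℝ × (ℤ → ℝ) | p.2 b < p.1} :=
      measurableSet_lt (by fun_prop) (by fun_prop)
    have h2 : MeasurableSet {p : ℝ × (ℤ → ℝ) | p.1 < y} :=
      measurableSet_lt (by fun_prop) (by fun_prop)
    exact (measurable_snd hS).inter (h1.inter h2)
  have hm2 : MeasurableSet (S ∩ {T : ℤ → ℝ | T b < T a ∧ T a < y}) := by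
    have h1 : MeasurableSet {T : ℤ → ℝ | T b < T a} :=
      measurableSet_lt (by fun_prop) (by fun_prop)
    have h2 : MeasurableSet {T : ℤ → ℝ | T a < y} :=
      measurableSet_lt (by fun_prop) (by fun_prop)
    exact hS.inter (h1.inter h2)
  have key : P (S ∩ {T | T b < T a ∧ T a < y}) =
      (lam.prod P) {p : ℝ × (ℤ → ℝ) | p.2 ∈ S ∧ p.2 b < p.1 ∧ p.1 < y} := by
    have e1 : lam.prod P = (P.prod P).map (Prod.map (fun T => T a) id) := by
      rw [← Measure.map_prod_map _ _ (by fun_prop) (by fun_prop), unif_eval hP, Measure.map_id]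
    rw [e1, Measure.map_apply (by fun_prop) hm]
    conv_lhs => rw [← unif_glue hP {a}]
    rw [Measure.map_apply (glue_meas _) hm2]
    congr 1
    ext p
    have : glue {a} p ∈ S ↔ p.2 ∈ S := h _ _ (by intro i hi; simp [glue, show i ∉ ({a}:Set ℤ) from hi])
    simp [this, glue, hab]
  have hmono : Monotone (fun x => P.real (S ∩ {T | T b < x})) := by
    intro x x' hx
    refine measureReal_mono ?_
    intro T hT
    exact ⟨hT.1, lt_of_lt_of_le hT.2 hx⟩
  have hmono' : Monotone (fun x => P (S ∩ {T | T b < x})) := by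
    intro x x' hx
    refine measure_mono ?_
    intro T hT
    exact ⟨hT.1, lt_of_lt_of_le hT.2 hx⟩
  have e2 : ∀ x, P (Prod.mk x ⁻¹' {p : ℝ × (ℤ → ℝ) | p.2 ∈ S ∧ p.2 b < p.1 ∧ p.1 < y}) =
      (Iio y).indicator (fun x => P (S ∩ {T | T b < x})) x := by
    intro x
    by_cases hx : x < y
    · rw [indicator_of_mem (by exact hx)]
      congr 1
      ext T
      simp [hx]
    · rw [indicator_of_notMem (by exact hx)]
      convert measure_empty (μ := P)
      ext T
      simp [hx]
  have e3 : Iio y ∩ Icc (0:ℝ) 1 = Ico 0 y := by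
    ext x
    simp only [mem_inter_iff, mem_Iio, mem_Icc, mem_Ico]
    constructor
    · rintro ⟨h1, h2, h3⟩; exact ⟨h2, h1⟩
    · rintro ⟨h1, h2⟩; exact ⟨h2, h1, by linarith [hy.2]⟩
  rw [Measure.real, key, Measure.prod_apply hm, intervalIntegral.integral_of_le hy.1,
    lintegral_congr e2, lintegral_indicator measurableSet_Iio, lam,
    Measure.restrict_restrict measurableSet_Iio, e3, integral_Ioc_eq_integral_Ioo,
    ← integral_Ico_eq_integral_Ioo]
  symm
  refine integral_toReal hmono'.measurable.aemeasurable (Filter.Eventually.of_forall fun x => ?_)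
  exact measure_lt_top _ _

/-- The initial decreasing run of `f` has even length. -/
def EvS (f : ℕ → ℝ) : Prop := ∃ k : ℕ, (∀ l : ℕ, l < 2 * k → f (l + 1) < f l) ∧ f (2 * k) < f (2 * k + 1)

lemma evS_rec (f : ℕ → ℝ) (h1 : ∀ n, f n ≠ f (n + 1)) (h2 : ∃ n, ¬ f (n + 1) < f n) :
    EvS f ↔ ¬ (f 1 < f 0 ∧ EvS (fun n => f (n + 1))) := by
  constructor
  · rintro ⟨k, hk, hk'⟩ ⟨h0, k', hl, hl'⟩
    rcases lt_or_ge (2 * k) (2 * k' + 1) with h | h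
    · rcases Nat.eq_zero_or_pos (2 * k) with h3 | h3
      · rw [h3] at hk'
        exact absurd hk' (not_lt.mpr h0.le)
      · have : f (2 * k - 1 + 1 + 1) < f (2 * k - 1 + 1) := hl (2 * k - 1) (by omega)
        rw [Nat.sub_add_cancel h3] at this
        exact absurd hk' (not_lt.mpr this.le)
    · have := hk (2 * k' + 1) (by omega)
      exact absurd hl' (not_lt.mpr this.le)
  · intro h
    classical
    have hn := Nat.find_spec h2
    have hm : ∀ l, l < Nat.find h2 → f (l + 1) < f l := fun l hl => not_not.mp (Nat.find_min h2 hl)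
    generalize Nat.find h2 = n at hn hm
    have hn' : f n < f (n + 1) := lt_of_le_of_ne (not_lt.mp hn) (h1 n)
    rcases Nat.even_or_odd' n with ⟨k, rfl | rfl⟩
    · exact ⟨k, hm, hn'⟩
    · exact absurd ⟨hm 0 (by omega), k, fun l hl => hm (l + 1) (by omega), hn'⟩ h

def ER (i : ℤ) : Set (ℤ → ℝ) := {T | EvS (fun n => T (i + n))}
def EL (i : ℤ) : Set (ℤ → ℝ) := {T | EvS (fun n => T (i - n))}
def chain (n : ℕ) (i : ℤ) : Set (ℤ → ℝ) := {T | ∀ k : ℕ, k < n → T (i + k + 1) < T (i + k)}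
def below (i : ℤ) (y : ℝ) : Set (ℤ → ℝ) := {T | T i < y}
def less (i j : ℤ) : Set (ℤ → ℝ) := {T | T i < T j}

lemma O_eq (t : ℝ) (s : ℤ) : O t s = below s t ∩ (EL s ∩ ER s) := by
  ext T
  simp only [O, G, mem_iUnion, below, EL, ER, EvS, mem_inter_iff, mem_ofPred_eq]
  push_cast
  simp only [sub_add_eq_sub_sub, ← add_assoc]
  constructor
  · rintro ⟨j, k, h1, h2, h3, h4, h5⟩
    exact ⟨h1, ⟨j, h2, h3⟩, ⟨k, h4, h5⟩⟩
  · rintro ⟨h1, ⟨j, h2, h3⟩, ⟨k, h4, h5⟩⟩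
    exact ⟨j, k, h1, h2, h3, h4, h5⟩

lemma Dep.mono {S : Set (ℤ → ℝ)} {I J : Set ℤ} (h : Dep S I) (hIJ : I ⊆ J) : Dep S J :=
  fun T T' hT => h T T' (fun i hi => hT i (hIJ hi))

lemma Dep.inter {S S' : Set (ℤ → ℝ)} {I : Set ℤ} (h : Dep S I) (h' : Dep S' I) : Dep (S ∩ S') I :=
  fun T T' hT => and_congr (h T T' hT) (h' T T' hT)

lemma Dep.diff {S S' : Set (ℤ → ℝ)} {I : Set ℤ} (h : Dep S I) (h' : Dep S' I) : Dep (S \ S') I :=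
  fun T T' hT => and_congr (h T T' hT) (not_congr (h' T T' hT))

lemma dep_below (i : ℤ) (y : ℝ) {I : Set ℤ} (hi : i ∈ I) : Dep (below i y) I := by
  intro T T' h
  simp [below, h i hi]

lemma dep_less (i j : ℤ) {I : Set ℤ} (hi : i ∈ I) (hj : j ∈ I) : Dep (less i j) I := by
  intro T T' h
  simp [less, h i hi, h j hj]

lemma dep_ER (i : ℤ) : Dep (ER i) (Ici i) := by
  intro T T' h
  have : (fun n : ℕ => T (i + n)) = fun n : ℕ => T' (i + n) := by
    funext n
    exact h _ (by simp)
  simp [ER, this]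

lemma dep_EL (i : ℤ) : Dep (EL i) (Iic i) := by
  intro T T' h
  have : (fun n : ℕ => T (i - n)) = fun n : ℕ => T' (i - n) := by
    funext n
    exact h _ (by simp)
  simp [EL, this]

lemma dep_chain (n : ℕ) (i : ℤ) : Dep (chain n i) (Icc i (i + n)) := by
  intro T T' h
  refine forall_congr' fun k => forall_congr' fun hk => ?_
  rw [h _ (by simp; omega), h _ (by simp; omega)]

lemma meas_below (i : ℤ) (y : ℝ) : MeasurableSet (below i y) :=
  measurableSet_lt (by fun_prop) (by fun_prop)

lemma meas_less (i j : ℤ) : MeasurableSet (less i j) :=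
  measurableSet_lt (by fun_prop) (by fun_prop)

lemma meas_chain (n : ℕ) (i : ℤ) : MeasurableSet (chain n i) := by
  have : chain n i = ⋂ (k : ℕ) (_ : k < n), less (i + k + 1) (i + k) := by
    ext T; simp [chain, less]
  rw [this]
  exact MeasurableSet.iInter fun k => MeasurableSet.iInter fun _ => meas_less _ _

lemma meas_evS : MeasurableSet {f : ℕ → ℝ | EvS f} := by
  have hl : ∀ i j : ℕ, MeasurableSet {f : ℕ → ℝ | f i < f j} := fun i j =>
    measurableSet_lt (by fun_prop) (by fun_prop)
  have : {f : ℕ → ℝ | EvS f} = ⋃ k : ℕ,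
      ((⋂ (l : ℕ) (_ : l < 2 * k), {f : ℕ → ℝ | f (l + 1) < f l}) ∩ {f | f (2 * k) < f (2 * k + 1)}) := by
    ext f; simp [EvS]
  rw [this]
  exact MeasurableSet.iUnion fun k => (MeasurableSet.iInter fun l =>
    MeasurableSet.iInter fun _ => hl _ _).inter (hl _ _)

lemma meas_ER (i : ℤ) : MeasurableSet (ER i) := by
  have h : Measurable (fun (T : ℤ → ℝ) (n : ℕ) => T (i + n)) := by fun_prop
  exact h meas_evS

lemma meas_EL (i : ℤ) : MeasurableSet (EL i) := by
  have h : Measurable (fun (T : ℤ → ℝ) (n : ℕ) => T (i - n)) := by fun_prop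
  exact h meas_evS

section
variable {P : Measure (ℤ → ℝ)}

lemma P_below (hP : IsUniformProduct P) (i : ℤ) {y : ℝ} (hy : y ∈ Icc (0:ℝ) 1) :
    P.real (below i y) = y := by
  have h := unif_eval hP i
  have h2 : P (below i y) = lam (Iio y) := by
    rw [← h, Measure.map_apply (by fun_prop) measurableSet_Iio]
    rfl
  have e3 : Iio y ∩ Icc (0:ℝ) 1 = Ico 0 y := by
    ext x
    simp only [mem_inter_iff, mem_Iio, mem_Icc, mem_Ico]
    constructor
    · rintro ⟨h1, h2, h3⟩; exact ⟨h2, h1⟩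
    · rintro ⟨h1, h2⟩; exact ⟨h2, h1, by linarith [hy.2]⟩
  rw [Measure.real, h2, lam, Measure.restrict_apply measurableSet_Iio, e3]
  simp [hy.1]

lemma P_chain (hP : IsUniformProduct P) (n : ℕ) : ∀ (i : ℤ) {y : ℝ}, y ∈ Icc (0:ℝ) 1 →
    P.real (below i y ∩ chain n i) = y ^ (n + 1) / (n + 1).factorial := by
  induction n with
  | zero =>
    intro i y hy
    have : chain 0 i = univ := by ext T; simp [chain]
    simp [this, P_below hP i hy]
  | succ n ih =>
    intro i y hy
    have e : below i y ∩ chain (n + 1) i =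
        chain n (i + 1) ∩ {T | T (i + 1) < T i ∧ T i < y} := by
      ext T
      simp only [below, chain, mem_inter_iff, mem_ofPred_eq]
      constructor
      · rintro ⟨h1, h2⟩
        refine ⟨fun k hk => ?_, by simpa using h2 0 (by omega), h1⟩
        have := h2 (k + 1) (by omega)
        push_cast at this
        convert this using 2 <;> ring
      · rintro ⟨h1, h2, h3⟩
        refine ⟨h3, fun k hk => ?_⟩
        rcases k with _ | k
        · simpa using h2
        · have := h1 k (by omega)
          push_cast
          convert this using 2 <;> ring
    rw [e, unif_integrate hP (meas_chain _ _) (by omega) ((dep_chain _ _).mono ?_) hy]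
    · have : ∀ x ∈ uIcc 0 y, P.real (chain n (i + 1) ∩ {T | T (i + 1) < x}) =
          x ^ (n + 1) / (n + 1).factorial := by
        intro x hx
        rw [uIcc_of_le hy.1] at hx
        rw [inter_comm]
        exact ih (i + 1) ⟨hx.1, hx.2.trans hy.2⟩
      rw [intervalIntegral.integral_congr this, intervalIntegral.integral_div, integral_pow]
      rw [Nat.factorial_succ (n + 1)]
      push_cast
      field_simp
      simp
    · intro j hj
      simp only [mem_Icc] at hj
      simp; omega

lemma P_less (hP : IsUniformProduct P) {a b : ℤ} (h : b ≠ a) : 1 / 2 ≤ P.real (less b a) := by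
  have := unif_prob hP
  have h1 := unif_integrate hP (MeasurableSet.univ) h (fun _ _ _ => by simp) (y := 1) (by simp)
  have h2 : ∫ x in (0:ℝ)..1, P.real (univ ∩ {T : ℤ → ℝ | T b < x}) = 1 / 2 := by
    have : ∀ x ∈ uIcc (0:ℝ) 1, P.real (univ ∩ {T : ℤ → ℝ | T b < x}) = x := by
      intro x hx
      rw [uIcc_of_le zero_le_one] at hx
      rw [univ_inter]
      exact P_below hP b hx
    rw [intervalIntegral.integral_congr this]
    norm_num
  rw [h2] at h1
  rw [← h1]
  refine measureReal_mono ?_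
  rintro T ⟨_, h, _⟩
  exact h

lemma ae_ne (hP : IsUniformProduct P) {a b : ℤ} (h : a ≠ b) : ∀ᵐ T ∂P, T a ≠ T b := by
  have := unif_prob hP
  have h1 := P_less hP h
  have h2 := P_less hP h.symm
  have hd : Disjoint (less a b) (less b a) := by
    rw [Set.disjoint_left]
    intro T hT hT'
    exact lt_asymm (show T a < T b from hT) hT'
  have h3 := measureReal_union (μ := P) hd (meas_less b a)
  have h4 : P.real ((less a b ∪ less b a)ᶜ) = 0 := by
    have := probReal_add_probReal_compl (μ := P) ((meas_less a b).union (meas_less b a))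
    have h5 := measureReal_nonneg (μ := P) (s := (less a b ∪ less b a)ᶜ)
    linarith
  rw [measureReal_eq_zero_iff] at h4
  rw [ae_iff]
  refine measure_mono_null ?_ h4
  intro T hT
  simp only [not_not, mem_ofPred_eq, ne_eq] at hT
  simp [less, hT]

lemma ae_lt_one (hP : IsUniformProduct P) (i : ℤ) : ∀ᵐ T ∂P, T i < 1 := by
  have := unif_prob hP
  have h1 := P_below hP i (y := 1) (by simp)
  have h2 := probReal_compl_eq_one_sub (μ := P) (meas_below i 1)
  rw [h1, sub_self, measureReal_eq_zero_iff] at h2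
  exact h2

lemma ae_run (hP : IsUniformProduct P) (i : ℤ) :
    ∀ᵐ T ∂P, ∃ k : ℕ, ¬ T (i + k + 1) < T (i + k) := by
  have := unif_prob hP
  have h0 : P.real (below i 1 ∩ ⋂ n, chain n i) = 0 := by
    refine le_antisymm ?_ measureReal_nonneg
    have hlim := (FloorSemiring.tendsto_pow_div_factorial_atTop (1 : ℝ)).comp
      (Filter.tendsto_add_atTop_nat 1)
    refine ge_of_tendsto' hlim (fun n => ?_)
    simp only [Function.comp]
    rw [← P_chain hP n i (y := 1) (by simp)]
    exact measureReal_mono (inter_subset_inter_right _ (iInter_subset _ _))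
  rw [measureReal_eq_zero_iff] at h0
  have h1 : ∀ᵐ T ∂P, T ∉ below i 1 ∩ ⋂ n, chain n i := measure_eq_zero_iff_ae_notMem.mp h0
  filter_upwards [h1, ae_lt_one hP i] with T hT hT1
  by_contra! hc
  exact hT ⟨hT1, by simp only [mem_iInter]; exact fun n k _ => hc k⟩

lemma unif_reflect (hP : IsUniformProduct P) {S : Set (ℤ → ℝ)} (hS : MeasurableSet S) :
    P.real {T | (fun i => T (-i)) ∈ S} = P.real S := by
  conv_rhs => rw [Measure.real, ← unif_reindex hP (Equiv.neg ℤ)]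
  rw [Measure.map_apply (by fun_prop) hS]
  rfl

lemma ae_reflect (hP : IsUniformProduct P) {p : (ℤ → ℝ) → Prop} (h : ∀ᵐ T ∂P, p T) :
    ∀ᵐ T ∂P, p (fun i => T (-i)) := by
  have hmap : ∀ᵐ T ∂(P.map (fun T i => T (Equiv.neg ℤ i))), p T := by
    rw [unif_reindex hP]; exact h
  exact ae_of_ae_map (measurable_pi_lambda _ (fun i => measurable_pi_apply _)).aemeasurable hmap

/-- Almost sure properties used below. -/
structure Good (T : ℤ → ℝ) : Prop where
  ne : ∀ i, T i ≠ T (i + 1)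
  er : ∀ i, T ∈ ER i ↔ ¬ (T (i + 1) < T i ∧ T ∈ ER (i + 1))
  el : ∀ i, T ∈ EL i ↔ ¬ (T (i - 1) < T i ∧ T ∈ EL (i - 1))

lemma ae_er (hP : IsUniformProduct P) :
    ∀ᵐ T ∂P, ∀ i, T ∈ ER i ↔ ¬ (T (i + 1) < T i ∧ T ∈ ER (i + 1)) := by
  rw [ae_all_iff]
  intro i
  have h1 : ∀ᵐ T ∂P, ∀ i : ℤ, T i ≠ T (i + 1) := ae_all_iff.mpr fun i => ae_ne hP (by omega)
  filter_upwards [h1, ae_run hP i] with T h1 h2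
  have := evS_rec (fun n => T (i + n)) (fun n => by
    have := h1 (i + n); push_cast; rwa [← add_assoc]) (by
    obtain ⟨k, hk⟩ := h2
    refine ⟨k, ?_⟩
    push_cast
    rwa [← add_assoc])
  have e : (fun n : ℕ => T (i + (n + 1 : ℕ))) = fun n : ℕ => T (i + 1 + n) := by
    funext n; congr 1; push_cast; ring
  rw [e] at this
  simpa [ER] using this

lemma EL_reflect (T : ℤ → ℝ) (i : ℤ) : T ∈ EL i ↔ (fun i => T (-i)) ∈ ER (-i) := by
  have : (fun n : ℕ => T (i - n)) = fun n : ℕ => T (-(-i + n)) := by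
    funext n; congr 1; ring
  simp only [EL, ER, mem_ofPred_eq, this]

lemma ae_good (hP : IsUniformProduct P) : ∀ᵐ T ∂P, Good T := by
  have h1 : ∀ᵐ T ∂P, ∀ i : ℤ, T i ≠ T (i + 1) := ae_all_iff.mpr fun i => ae_ne hP (by omega)
  filter_upwards [h1, ae_er hP, ae_reflect hP (ae_er hP)] with T h1 h2 h3
  refine ⟨h1, h2, fun i => ?_⟩
  rw [EL_reflect, EL_reflect, h3 (-i)]
  have e : -(i - 1) = -i + 1 := by ring
  rw [e, neg_neg]
  have e : -(-i + 1) = i - 1 := by ring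
  rw [e]
end

section
variable {P : Measure (ℤ → ℝ)}

lemma real_congr {S S' : Set (ℤ → ℝ)} (hP : IsUniformProduct P)
    (h : ∀ T, Good T → (T ∈ S ↔ T ∈ S')) : P.real S = P.real S' := by
  have : S =ᵐ[P] S' := by
    rw [Filter.eventuallyEq_set]
    filter_upwards [ae_good hP] with T hT using h T hT
  exact measureReal_congr this

/-- Additivity up to null sets. -/
lemma real_add {S A B : Set (ℤ → ℝ)} (hP : IsUniformProduct P) (hB : MeasurableSet B)
    (h : ∀ T, Good T → (T ∈ S ↔ T ∈ A ∨ T ∈ B)) (hd : ∀ T, Good T → T ∈ A → T ∈ B → False) :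
    P.real S = P.real A + P.real B := by
  have := unif_prob hP
  have e : P.real A = P.real (A \ B) :=
    real_congr hP fun T hT => ⟨fun h => ⟨h, fun h' => hd T hT h h'⟩, fun h => h.1⟩
  rw [e, ← measureReal_union Set.disjoint_sdiff_left hB]
  refine real_congr hP fun T hT => ?_
  rw [h T hT, Set.sdiff_union_self]
  rfl

lemma P_ER_rec (hP : IsUniformProduct P) (i : ℤ) {y : ℝ} (hy : y ∈ Icc (0:ℝ) 1) :
    P.real (below i y ∩ ER i) = y - ∫ x in (0:ℝ)..y, P.real (below (i + 1) x ∩ ER (i + 1)) := by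
  have h1 := unif_integrate hP (meas_ER (i + 1)) (a := i) (b := i + 1) (by omega)
    ((dep_ER _).mono (by intro j hj; simp only [mem_Ici] at hj; simp; omega)) hy
  have h2 : P.real (below i y) = P.real (below i y ∩ ER i) +
      P.real (ER (i + 1) ∩ {T | T (i + 1) < T i ∧ T i < y}) := by
    refine real_add hP ?_ ?_ ?_
    · exact (meas_ER _).inter ((meas_less _ _).inter (meas_below _ _))
    · intro T hT
      have := hT.er i
      simp only [below, mem_inter_iff, mem_ofPred_eq]
      tauto
    · rintro T hT ⟨_, h2⟩ ⟨h3, h4, _⟩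
      exact (hT.er i).mp h2 ⟨h4, h3⟩
  rw [h1, P_below hP i hy] at h2
  simp only [inter_comm (ER (i + 1))] at h2
  simp only [below] at *
  linarith

lemma P_ER_bound (hP : IsUniformProduct P) (n : ℕ) : ∀ (i : ℤ) {y : ℝ}, y ∈ Icc (0:ℝ) 1 →
    |P.real (below i y ∩ ER i) - (1 - Real.exp (-y))| ≤ y ^ n / n.factorial := by
  have := unif_prob hP
  induction n with
  | zero =>
    intro i y hy
    have h1 : P.real (below i y ∩ ER i) ≤ 1 := measureReal_le_one
    have h2 : 0 ≤ P.real (below i y ∩ ER i) := measureReal_nonneg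
    have h3 : Real.exp (-y) ≤ 1 := by simpa using hy.1
    have h4 := Real.exp_pos (-y)
    simp only [pow_zero, Nat.factorial_zero, Nat.cast_one, div_one]
    rw [abs_le]
    constructor <;> linarith
  | succ n ih =>
    intro i y hy
    rw [P_ER_rec hP i hy]
    have hmono : Monotone (fun x => P.real (below (i + 1) x ∩ ER (i + 1))) := by
      intro x x' hx
      refine measureReal_mono ?_
      rintro T ⟨h1, h2⟩
      exact ⟨lt_of_lt_of_le h1 hx, h2⟩
    have hc : Continuous (fun x : ℝ => 1 - Real.exp (-x)) := by fun_prop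
    have e : ∫ x in (0:ℝ)..y, (1 - Real.exp (-x)) = y - (1 - Real.exp (-y)) := by
      rw [intervalIntegral.integral_eq_sub_of_hasDerivAt (f := fun x => x + Real.exp (-x))
        _ (hc.intervalIntegrable _ _)]
      · simp; ring
      · intro x _
        have h1 : HasDerivAt (fun x : ℝ => Real.exp (-x)) (-Real.exp (-x)) x := by
          simpa using (hasDerivAt_id x).neg.exp
        have h2 := (hasDerivAt_id' x).fun_add h1
        rwa [← sub_eq_add_neg] at h2
    have e2 : y - (∫ x in (0:ℝ)..y, P.real (below (i + 1) x ∩ ER (i + 1))) - (1 - Real.exp (-y)) =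
        -∫ x in (0:ℝ)..y, (P.real (below (i + 1) x ∩ ER (i + 1)) - (1 - Real.exp (-x))) := by
      rw [intervalIntegral.integral_sub hmono.intervalIntegrable (hc.intervalIntegrable _ _), e]
      ring
    rw [e2, abs_neg, ← Real.norm_eq_abs]
    have hb : ∫ x in (0:ℝ)..y, x ^ n / (n.factorial : ℝ) = y ^ (n + 1) / (n + 1).factorial := by
      rw [intervalIntegral.integral_div, integral_pow, Nat.factorial_succ]
      push_cast
      field_simp
      simp
    rw [← hb]
    refine intervalIntegral.norm_integral_le_of_norm_le hy.1 ?_ ?_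
    · refine Filter.Eventually.of_forall fun x hx => ?_
      rw [Real.norm_eq_abs]
      exact ih (i + 1) ⟨hx.1.le, hx.2.trans hy.2⟩
    · exact (Continuous.intervalIntegrable (by fun_prop) _ _)

lemma P_ER (hP : IsUniformProduct P) (i : ℤ) {y : ℝ} (hy : y ∈ Icc (0:ℝ) 1) :
    P.real (below i y ∩ ER i) = 1 - Real.exp (-y) := by
  have h : |P.real (below i y ∩ ER i) - (1 - Real.exp (-y))| ≤ 0 :=
    ge_of_tendsto' (FloorSemiring.tendsto_pow_div_factorial_atTop y)
      (fun n => P_ER_bound hP n i hy)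
  have := abs_nonpos_iff.mp h
  linarith

lemma P_left (hP : IsUniformProduct P) {y : ℝ} (hy : y ∈ Icc (0:ℝ) 1) :
    P.real (below (-1) y \ EL (-1)) = Real.exp (-y) - 1 + y := by
  have h1 : P.real (below (-1) y) = P.real (below (-1) y \ EL (-1)) +
      P.real (below (-1) y ∩ EL (-1)) := by
    refine real_add hP ((meas_below _ _).inter (meas_EL _)) (fun T _ => ?_) (fun T _ => ?_)
    · simp only [mem_sdiff, mem_inter_iff]; tauto
    · rintro ⟨_, h⟩ ⟨_, h'⟩; exact h h'
  have h2 : P.real (below (-1) y ∩ EL (-1)) = 1 - Real.exp (-y) := by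
    rw [← P_ER hP 1 hy, ← unif_reflect hP ((meas_below _ _).inter (meas_ER _))]
    congr 1
    ext T
    simp only [mem_inter_iff, EL_reflect, mem_ofPred_eq, below, neg_neg]
  rw [P_below hP _ hy, h2] at h1
  linarith

end

/-- The decreasing run from `0`, with `T 0 < t`, ends exactly at `j`. -/
def FinAt (t : ℝ) (j : ℕ) : Set (ℤ → ℝ) := below 0 t ∩ chain j 0 ∩ less j (j + 1)

open Classical in
/-- The decreasing run from `0`, with `T 0 < t`, has odd length less than `j`. -/
noncomputable def Q (t : ℝ) : ℕ → Set (ℤ → ℝ)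
  | 0 => ∅
  | j + 1 => Q t j ∪ (if Odd j then FinAt t j else ∅)

/-- The part of `Q t j` where the run leftwards from `j` has even length. -/
noncomputable def U (t : ℝ) : ℕ → Set (ℤ → ℝ)
  | 0 => ∅
  | j + 1 => Q t j \ (U t j ∩ less j (j + 1))

lemma mem_Q (t : ℝ) (j : ℕ) (T : ℤ → ℝ) : T ∈ Q t j ↔ ∃ m < j, Odd m ∧ T ∈ FinAt t m := by
  induction j with
  | zero => simp [Q]
  | succ j ih =>
    simp only [Q, mem_union, ih]
    constructor
    · rintro (⟨m, h1, h2⟩ | h)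
      · exact ⟨m, by omega, h2⟩
      · split_ifs at h with ho
        · exact ⟨j, by omega, ho, h⟩
        · simp at h
    · rintro ⟨m, h1, h2, h3⟩
      rcases Nat.lt_succ_iff_lt_or_eq.mp h1 with h | rfl
      · exact Or.inl ⟨m, h, h2, h3⟩
      · right; rwa [if_pos h2]

lemma meas_Fin (t : ℝ) (j : ℕ) : MeasurableSet (FinAt t j) :=
  ((meas_below _ _).inter (meas_chain _ _)).inter (meas_less _ _)

lemma meas_Q (t : ℝ) (j : ℕ) : MeasurableSet (Q t j) := by
  induction j with
  | zero => exact MeasurableSet.empty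
  | succ j ih =>
    simp only [Q]
    refine ih.union ?_
    split_ifs
    · exact meas_Fin t j
    · exact MeasurableSet.empty

lemma meas_U (t : ℝ) (j : ℕ) : MeasurableSet (U t j) := by
  induction j with
  | zero => exact MeasurableSet.empty
  | succ j ih => exact (meas_Q t j).diff (ih.inter (meas_less _ _))

lemma dep_Q (t : ℝ) (j : ℕ) : Dep (Q t j) (Icc 0 j) := by
  intro T T' h
  simp only [mem_Q]
  refine exists_congr fun m => and_congr_right fun hm => and_congr_right fun _ => ?_
  refine (((dep_below _ _ ?_).inter ((dep_chain _ _).mono ?_)).inter (dep_less _ _ ?_ ?_)) T T' h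
  · simp
  · intro i hi; simp only [mem_Icc] at *; omega
  · simp only [mem_Icc]; omega
  · simp only [mem_Icc]; omega

lemma dep_U (t : ℝ) (j : ℕ) : Dep (U t j) (Icc 0 j) := by
  induction j with
  | zero => intro T T' _; simp [U]
  | succ j ih =>
    refine ((dep_Q t j).mono ?_).diff ((ih.mono ?_).inter (dep_less _ _ ?_ ?_))
    · intro i hi; simp only [mem_Icc] at *; push_cast; omega
    · intro i hi; simp only [mem_Icc] at *; push_cast; omega
    · simp only [mem_Icc]; push_cast; omega
    · simp only [mem_Icc]; push_cast; omega

lemma U_sub_Q (t : ℝ) (j : ℕ) : U t j ⊆ Q t j := by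
  cases j with
  | zero => simp [U]
  | succ j => exact fun T hT => Or.inl hT.1

lemma chain_lt {m j : ℕ} {T : ℤ → ℝ} (h : T ∈ chain j 0) (hm : m < j) : T (m + 1) < T m := by
  simpa using h m hm

lemma chain_succ (j : ℕ) (T : ℤ → ℝ) : T ∈ chain (j + 1) 0 ↔ T ∈ chain j 0 ∧ T (j + 1) < T j := by
  constructor
  · intro h
    exact ⟨fun k hk => h k (by omega), chain_lt h (by omega)⟩
  · rintro ⟨h1, h2⟩ k hk
    rcases Nat.lt_succ_iff_lt_or_eq.mp hk with h | rfl
    · exact h1 k h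
    · simpa using h2

section
variable {P : Measure (ℤ → ℝ)}

lemma Good.lt_or (T : ℤ → ℝ) (h : Good T) (i : ℤ) : T i < T (i + 1) ∨ T (i + 1) < T i :=
  lt_or_gt_of_ne (h.ne i)

lemma P_Fin (hP : IsUniformProduct P) {t : ℝ} (ht : t ∈ Icc (0:ℝ) 1) (j : ℕ) :
    P.real (FinAt t j) = t ^ (j + 1) / (j + 1).factorial - t ^ (j + 2) / (j + 2).factorial := by
  have h : P.real (below 0 t ∩ chain j 0) = P.real (FinAt t j) +
      P.real (below 0 t ∩ chain (j + 1) 0) := by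
    refine real_add hP ((meas_below _ _).inter (meas_chain _ _)) ?_ ?_
    · intro T hT
      have := hT.lt_or T j
      simp only [FinAt, mem_inter_iff, chain_succ]
      simp only [less, mem_ofPred_eq]
      tauto
    · rintro T hT ⟨_, h⟩ ⟨_, h'⟩
      exact lt_asymm (show T j < T (j + 1) from h) (chain_lt h' (by omega))
  rw [P_chain hP _ _ ht, P_chain hP _ _ ht] at h
  linarith

lemma W_succ_odd (hP : IsUniformProduct P) {t : ℝ} (ht : t ∈ Icc (0:ℝ) 1) (j : ℕ) (hj : Odd j) :
    P.real (Q t (j + 1)) = P.real (Q t j) +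
      (t ^ (j + 1) / (j + 1).factorial - t ^ (j + 2) / (j + 2).factorial) := by
  rw [← P_Fin hP ht j]
  refine real_add hP (meas_Fin t j) ?_ ?_
  · intro T _
    simp [Q, hj]
  · intro T _ h1 h2
    obtain ⟨m, hm, _, h3⟩ := (mem_Q _ _ _).mp h1
    exact lt_asymm (show T m < T (m + 1) from h3.2) (chain_lt h2.1.2 hm)

lemma W_succ_even (t : ℝ) (j : ℕ) (hj : Even j) : P.real (Q t (j + 1)) = P.real (Q t j) := by
  simp only [Q]
  rw [if_neg (Nat.not_odd_iff_even.mpr hj), union_empty]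

lemma g_succ (hP : IsUniformProduct P) (t : ℝ) (j : ℕ) {y : ℝ} (hy : y ∈ Icc (0:ℝ) 1) :
    P.real (U t (j + 1) ∩ below (j + 1) y) =
      P.real (Q t j) * y - ∫ x in (0:ℝ)..y, P.real (U t j ∩ below j x) := by
  have h1 := unif_integrate hP (meas_U t j) (a := j + 1) (b := j) (by omega)
    ((dep_U t j).mono (by intro i hi; simp only [mem_Icc] at hi; simp; omega)) hy
  have h2 : P.real (Q t j ∩ below (j + 1) y) = P.real (U t (j + 1) ∩ below (j + 1) y) +
      P.real (U t j ∩ {T | T j < T (j + 1) ∧ T (j + 1) < y}) := by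
    refine real_add hP ((meas_U t j).inter ((meas_less _ _).inter (meas_below _ _))) ?_ ?_
    · intro T _
      have := @U_sub_Q t j T
      simp only [U, below, less, mem_inter_iff, mem_sdiff, mem_ofPred_eq]
      tauto
    · rintro T _ ⟨⟨_, h1⟩, _⟩ ⟨h2, h3, _⟩
      exact h1 ⟨h2, h3⟩
  rw [h1, unif_indep hP (meas_Q t j) (meas_below _ _) (Icc 0 j) (dep_Q t j)
    (dep_below _ _ (by simp)), P_below hP _ hy] at h2
  simp only [below] at *
  linarith

lemma J_succ (hP : IsUniformProduct P) {t : ℝ} (ht : t ∈ Icc (0:ℝ) 1) (j : ℕ) :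
    P.real (U t (j + 1) ∩ (below (j + 1) t ∩ ER (j + 1))) + P.real (U t j ∩ (below j t ∩ ER j)) =
      P.real (Q t j) * (1 - Real.exp (-t)) + P.real (U t j ∩ below j t) * Real.exp (-t) := by
  have mH : MeasurableSet (below (j + 1) t ∩ ER (j + 1)) := (meas_below _ _).inter (meas_ER _)
  have dH : Dep (below (j + 1) t ∩ ER (j + 1)) (Icc (0:ℤ) j)ᶜ := by
    refine (dep_below _ _ (by simp)).inter ((dep_ER _).mono ?_)
    intro i hi; simp only [mem_Ici] at hi; simp; omega
  have h1 : P.real (Q t j ∩ (below (j + 1) t ∩ ER (j + 1))) =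
      P.real (U t (j + 1) ∩ (below (j + 1) t ∩ ER (j + 1))) +
      P.real (U t j ∩ less j (j + 1) ∩ (below (j + 1) t ∩ ER (j + 1))) := by
    refine real_add hP (((meas_U t j).inter (meas_less _ _)).inter mH) ?_ ?_
    · intro T _
      have := @U_sub_Q t j T
      simp only [U, mem_inter_iff, mem_sdiff]
      tauto
    · rintro T _ ⟨⟨_, h1⟩, _⟩ ⟨h2, _⟩
      exact h1 h2
  have h2 : P.real (U t j ∩ below j t) = P.real (U t j ∩ (below j t ∩ ER j)) +
      P.real (U t j ∩ less (j + 1) j ∩ below j t ∩ ER (j + 1)) := by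
    refine real_add hP ((((meas_U t j).inter (meas_less _ _)).inter (meas_below _ _)).inter
      (meas_ER _)) ?_ ?_
    · intro T hT
      have := hT.er j
      simp only [less, mem_inter_iff, mem_ofPred_eq]
      tauto
    · rintro T hT ⟨_, _, h1⟩ ⟨⟨⟨_, h2⟩, _⟩, h3⟩
      exact (hT.er j).mp h1 ⟨h2, h3⟩
  have h3 : P.real (U t j ∩ below j t ∩ (below (j + 1) t ∩ ER (j + 1))) =
      P.real (U t j ∩ less j (j + 1) ∩ (below (j + 1) t ∩ ER (j + 1))) +
      P.real (U t j ∩ less (j + 1) j ∩ below j t ∩ ER (j + 1)) := by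
    refine real_add hP ((((meas_U t j).inter (meas_less _ _)).inter (meas_below _ _)).inter
      (meas_ER _)) ?_ ?_
    · intro T hT
      have h := hT.lt_or T j
      have h' : T j < T (j + 1) → T (j + 1) < t → T j < t := lt_trans
      have h'' : T (j + 1) < T j → T j < t → T (j + 1) < t := lt_trans
      simp only [less, below, mem_inter_iff, mem_ofPred_eq]
      tauto
    · rintro T hT ⟨⟨_, h1⟩, _⟩ ⟨⟨⟨_, h2⟩, _⟩, _⟩
      exact lt_asymm (show T j < T (j + 1) from h1) h2
  rw [unif_indep hP (meas_Q t j) mH _ (dep_Q t j) dH, P_ER hP _ ht] at h1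
  rw [unif_indep hP ((meas_U t j).inter (meas_below _ _)) mH _
    ((dep_U t j).inter (dep_below _ _ (by simp))) dH, P_ER hP _ ht] at h3
  linarith

end

/-- Along a decreasing run the parity alternates. -/
lemma Good.er_chain {T : ℤ → ℝ} (hT : Good T) (m : ℕ) (h : T ∈ chain m 0) :
    T ∈ ER 0 ↔ (Even m ↔ T ∈ ER m) := by
  induction m with
  | zero => simp
  | succ m ih =>
    rw [chain_succ] at h
    have h1 := ih h.1
    have h2 := hT.er m
    have h3 := h.2
    rw [h1, h2, Nat.even_add_one]
    push_cast
    tauto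

lemma Good.er_of_lt {T : ℤ → ℝ} (hT : Good T) (i : ℤ) (h : T i < T (i + 1)) : T ∈ ER i := by
  rw [hT.er]
  exact fun h' => lt_asymm h h'.1

lemma mem_U {T : ℤ → ℝ} (hT : Good T) (t : ℝ) (j : ℕ) : T ∈ U t j ↔ T ∈ Q t j ∧ T ∈ EL j := by
  induction j with
  | zero => simp [U, Q]
  | succ j ih =>
    have h1 := hT.el (j + 1)
    rw [add_sub_cancel_right] at h1
    have h2 : T ∈ Q t (j + 1) → T ∈ EL (j + 1) → T ∈ Q t j := by
      intro h3 h4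
      simp only [Q] at h3
      rcases h3 with h3 | h3
      · exact h3
      · exfalso
        split_ifs at h3 with ho
        · obtain ⟨k, rfl⟩ := ho
          have h5 : T ((2 * k : ℕ) + 1) < T (2 * k : ℕ) := chain_lt h3.1.2 (by omega)
          refine h1.mp h4 ⟨h3.2, ?_⟩
          rw [hT.el]
          rintro ⟨h6, _⟩
          push_cast at h5 h6
          rw [add_sub_cancel_right] at h6
          exact lt_asymm h5 h6
        · exact h3
    have h3 : T ∈ Q t j → T ∈ Q t (j + 1) := fun h => Or.inl h
    simp only [U, mem_sdiff, mem_inter_iff, ih]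
    simp only [less, mem_ofPred_eq]
    push_cast
    tauto

lemma mem_Q_iff {T : ℤ → ℝ} (hT : Good T) {t : ℝ} {s : ℕ} (hs : Even s) (hE : T ∈ ER s)
    (h0 : T 0 < t) : T ∈ Q t s ↔ T ∉ ER 0 := by
  rw [mem_Q]
  constructor
  · rintro ⟨m, hm, ho, h⟩
    rw [hT.er_chain m h.1.2]
    have h1 := hT.er_of_lt m h.2
    simp [h1, ho]
  · intro h
    by_contra hc
    push Not at hc
    have key : ∀ m ≤ s, T ∈ chain m 0 := by
      intro m
      induction m with
      | zero => intro _ k hk; omega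
      | succ m ih =>
        intro hm
        have h1 := ih (by omega)
        rw [chain_succ]
        refine ⟨h1, ?_⟩
        rcases hT.lt_or T m with h2 | h2
        · exfalso
          rcases Nat.even_or_odd m with he | ho
          · apply h
            rw [hT.er_chain m h1]
            simp [he, hT.er_of_lt m h2]
          · exact hc m (by omega) ho ⟨⟨h0, h1⟩, h2⟩
        · exact h2
    apply h
    rw [hT.er_chain s (key s le_rfl)]
    simp [hs, hE]

lemma main_event {T : ℤ → ℝ} (hT : Good T) (t : ℝ) {s : ℕ} (hs : Even s) :
    T ∈ D t s ∩ M2 t ↔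
      T ∈ (below (-1) t \ EL (-1)) ∩ (U t s ∩ (below s t ∩ ER s)) := by
  have h1 := hT.el 0
  have h2 := hT.er (-1)
  have h3 := hT.lt_or T (-1)
  have h4 : T ∈ ER s → T 0 < t → (T ∈ Q t s ↔ T ∉ ER 0) := mem_Q_iff hT hs
  have h5 : T ∈ Q t s → T 0 < t := by
    rw [mem_Q]
    rintro ⟨m, _, _, h⟩
    exact h.1.1
  have h6 : ¬ (T (-1) < T 0 ∧ T 0 < T (-1)) := fun h => lt_asymm h.1 h.2
  rw [zero_sub] at h1
  rw [neg_add_cancel] at h2 h3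
  simp only [D, M2, O_eq, mem_inter_iff, mem_sdiff, mem_compl_iff, mem_U hT, below, mem_ofPred_eq]
  tauto

lemma sum_pairs (f : ℕ → ℝ) (q : ℕ) :
    ∑ n ∈ Finset.range (2 * q), f n = ∑ i ∈ Finset.range q, (f (2 * i) + f (2 * i + 1)) := by
  induction q with
  | zero => simp
  | succ q ih =>
    rw [show 2 * (q + 1) = 2 * q + 1 + 1 by ring, Finset.sum_range_succ, Finset.sum_range_succ,
      Finset.sum_range_succ _ q, ih]
    ring

lemma sum_odd_choose (n q : ℕ) :
    ∑ i ∈ Finset.range q, ((n + 1).choose (2 * i + 1) : ℝ) =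
      ∑ m ∈ Finset.range (2 * q), (n.choose m : ℝ) := by
  rw [sum_pairs]
  refine Finset.sum_congr rfl fun i _ => ?_
  rw [Nat.choose_succ_succ]
  push_cast
  rfl

lemma sum_choose_real (n : ℕ) : ∑ m ∈ Finset.range (n + 1), (n.choose m : ℝ) = 2 ^ n := by
  exact_mod_cast Nat.sum_range_choose n

lemma binom_one (q : ℕ) :
    ∑ i ∈ Finset.range q, ((2 * q + 1).choose (2 * i + 1) : ℝ) = 2 ^ (2 * q) - 1 := by
  rw [sum_odd_choose]
  have := sum_choose_real (2 * q)
  rw [Finset.sum_range_succ] at this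
  simp only [Nat.choose_self, Nat.cast_one] at this
  linarith

lemma binom_two (q : ℕ) :
    ∑ i ∈ Finset.range q, ((2 * q + 2).choose (2 * i + 1) : ℝ) = 2 ^ (2 * q + 1) - (2 * q + 2) := by
  rw [sum_odd_choose (2 * q + 1)]
  have := sum_choose_real (2 * q + 1)
  rw [Finset.sum_range_succ, Finset.sum_range_succ] at this
  simp only [Nat.choose_self, Nat.cast_one, Nat.choose_succ_self_right] at this
  push_cast at this
  linarith

lemma pow_mul_choose (t : ℝ) {n k m : ℕ} (h : k + m = n) :
    t ^ k / k.factorial * (t ^ m / m.factorial) = t ^ n / n.factorial * n.choose k := by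
  subst h
  have h1 := Nat.choose_mul_factorial_mul_factorial (Nat.le_add_right k m)
  rw [Nat.add_sub_cancel_left] at h1
  have h2 : ((k + m).choose k : ℝ) * k.factorial * m.factorial = (k + m).factorial := by
    exact_mod_cast h1
  have h3 : (k.factorial : ℝ) ≠ 0 := by positivity
  have h4 : (m.factorial : ℝ) ≠ 0 := by positivity
  rw [← h2]
  have h5 : ((k + m).choose k : ℝ) ≠ 0 := by
    exact_mod_cast (Nat.choose_pos (Nat.le_add_right k m)).ne'
  field_simp
  ring

section
variable {P : Measure (ℤ → ℝ)}

lemma g_closed (hP : IsUniformProduct P) (t : ℝ) (j : ℕ) : ∀ {y : ℝ}, y ∈ Icc (0:ℝ) 1 →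
    P.real (U t j ∩ below j y) = ∑ n ∈ Finset.range j,
      (-1) ^ n * P.real (Q t (j - 1 - n)) * (y ^ (n + 1) / (n + 1).factorial) := by
  induction j with
  | zero => intro y hy; simp [U]
  | succ j ih =>
    intro y hy
    push_cast
    rw [g_succ hP t j hy]
    have h : ∀ x ∈ uIcc 0 y, P.real (U t j ∩ below j x) = ∑ n ∈ Finset.range j,
      (-1) ^ n * P.real (Q t (j - 1 - n)) * (x ^ (n + 1) / (n + 1).factorial) := by
      intro x hx
      rw [uIcc_of_le hy.1] at hx
      exact ih ⟨hx.1, hx.2.trans hy.2⟩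
    rw [intervalIntegral.integral_congr h, intervalIntegral.integral_finsetSum
      (fun n _ => Continuous.intervalIntegrable (by fun_prop) _ _), Finset.sum_range_succ',
      add_comm, sub_eq_add_neg, ← Finset.sum_neg_distrib]
    congr 1
    · simp
    · refine Finset.sum_congr rfl fun n hn => ?_
      rw [intervalIntegral.integral_const_mul, intervalIntegral.integral_div, integral_pow,
        show j - (n + 1) = j - 1 - n by omega, Nat.factorial_succ (n + 1), pow_succ (-1 : ℝ) n]
      push_cast
      field_simp
      simp

lemma g_diff (hP : IsUniformProduct P) {t : ℝ} (ht : t ∈ Icc (0:ℝ) 1) (q : ℕ) :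
    P.real (U t (2 * q + 1) ∩ below ((2 * q + 1 : ℕ) : ℤ) t) -
      P.real (U t (2 * q) ∩ below ((2 * q : ℕ) : ℤ) t) =
      t ^ (2 * q + 1) / (2 * q + 1).factorial * (2 ^ (2 * q) - 1) -
      t ^ (2 * q + 2) / (2 * q + 2).factorial * (2 ^ (2 * q + 1) - (2 * q + 2)) := by
  rw [g_closed hP t _ ht, g_closed hP t _ ht, Finset.sum_range_succ]
  have h0 : P.real (Q t (2 * q + 1 - 1 - 2 * q)) = 0 := by
    rw [show 2 * q + 1 - 1 - 2 * q = 0 by omega]; simp [Q]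
  rw [h0, mul_zero, zero_mul, add_zero, ← Finset.sum_sub_distrib, sum_pairs, ← binom_one,
    ← binom_two, Finset.mul_sum, Finset.mul_sum, ← Finset.sum_sub_distrib]
  refine Finset.sum_congr rfl fun i hi => ?_
  rw [Finset.mem_range] at hi
  obtain ⟨r, rfl⟩ : ∃ r, q = i + r + 1 := ⟨q - i - 1, by omega⟩
  rw [show 2 * (i + r + 1) + 1 - 1 - 2 * i = 2 * r + 1 + 1 by omega,
    show 2 * (i + r + 1) - 1 - 2 * i = 2 * r + 1 by omega,
    show 2 * (i + r + 1) + 1 - 1 - (2 * i + 1) = 2 * r + 1 by omega,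
    show 2 * (i + r + 1) - 1 - (2 * i + 1) = 2 * r by omega,
    W_succ_odd hP ht (2 * r + 1) ⟨r, rfl⟩, W_succ_even t (2 * r) ⟨r, by ring⟩,
    ← pow_mul_choose t (show (2 * i + 1) + (2 * r + 1 + 1) = 2 * (i + r + 1) + 1 by ring),
    ← pow_mul_choose t (show (2 * i + 1) + (2 * r + 1 + 2) = 2 * (i + r + 1) + 2 by ring)]
  have : (-1 : ℝ) ^ (2 * i) = 1 := by simp [pow_mul]
  rw [this]
  ring

lemma J_closed (hP : IsUniformProduct P) {t : ℝ} (ht : t ∈ Icc (0:ℝ) 1) (q : ℕ) :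
    P.real (U t (2 * q + 2) ∩ (below ((2 * q + 2 : ℕ) : ℤ) t ∩ ER ((2 * q + 2 : ℕ) : ℤ))) =
      - Real.exp (-t) * ((1 / 2) * ∑ i ∈ Finset.Icc 3 (2 * q + 2), (-2 * t) ^ i / (Nat.factorial i) +
          (1 - t) * ∑ i ∈ Finset.range q, t ^ (2 * i + 3) / (Nat.factorial (2 * i + 3))) := by
  have step : ∀ q : ℕ,
      P.real (U t (2 * q + 2) ∩ (below ((2 * q + 2 : ℕ) : ℤ) t ∩ ER ((2 * q + 2 : ℕ) : ℤ))) =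
      P.real (U t (2 * q) ∩ (below ((2 * q : ℕ) : ℤ) t ∩ ER ((2 * q : ℕ) : ℤ))) +
      (t ^ (2 * q + 1) / (2 * q + 1).factorial * (2 ^ (2 * q) - 1) -
      t ^ (2 * q + 2) / (2 * q + 2).factorial * (2 ^ (2 * q + 1) - (2 * q + 2))) *
        Real.exp (-t) := by
    intro q
    have h1 := J_succ hP ht (2 * q)
    have h2 := J_succ hP ht (2 * q + 1)
    have h3 := W_succ_even (P := P) t (2 * q) ⟨q, by ring⟩
    rw [← g_diff hP ht]
    rw [h3] at h2
    push_cast at h1 h2 ⊢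
    rw [show (2 * (q : ℤ) + 1 + 1) = 2 * q + 2 by ring] at h2
    linarith
  induction q with
  | zero =>
    rw [step 0]
    simp [U]
  | succ q ih =>
    rw [step (q + 1), show 2 * (q + 1) = 2 * q + 2 by ring, ih, Finset.sum_range_succ,
      show 2 * q + 2 + 2 = 2 * q + 2 + 1 + 1 by ring,
      Finset.sum_Icc_succ_top (show 3 ≤ 2 * q + 2 + 1 + 1 by omega), Finset.sum_Icc_succ_top (show 3 ≤ 2 * q + 2 + 1 by omega),
      Nat.factorial_succ (2 * q + 2 + 1), show 2 * q + 2 + 1 = 2 * q + 3 by ring]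
    have hf : ((2 * q + 3).factorial : ℝ) ≠ 0 := by positivity
    have hf2 : (2 * (q:ℝ) + 4) ≠ 0 := by positivity
    have e1 : (-2 * t) ^ (2 * q + 3) = - (2 ^ (2 * q + 2) * 2 * t ^ (2 * q + 3)) := by
      rw [neg_mul, Odd.neg_pow ⟨q + 1, by ring⟩, mul_pow, pow_succ (2:ℝ) (2 * q + 2)]
    have e2 : (-2 * t) ^ (2 * q + 3 + 1) = 2 ^ (2 * q + 2) * 4 * (t ^ (2 * q + 3) * t) := by
      rw [pow_succ, e1]; ring
    rw [e1, e2, pow_succ t (2 * q + 3), pow_succ (2:ℝ) (2 * q + 2)]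
    push_cast
    rw [show (2 * (q:ℝ) + 3 + 1) = 2 * q + 4 by ring,
      show (2 * ((q:ℝ) + 1) + 2) = 2 * q + 4 by ring]
    field_simp
    ring

end

theorem gamma_two (P : Measure (ℤ → ℝ)) (hP : IsUniformProduct P)
    (t : ℝ) (ht : t ∈ Icc (0 : ℝ) 1) (s : ℕ) (hs : 2 ≤ s) (hse : Even s) :
    (P (D t s ∩ M2 t)).toReal =
      -(Real.exp (-t) - 1 + t) * Real.exp (-t) *
        ((1 / 2) * ∑ i ∈ Finset.Icc 3 s, (-2 * t) ^ i / (Nat.factorial i) +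
          (1 - t) *
            ∑ i ∈ Finset.range (s / 2 - 1), t ^ (2 * i + 3) / (Nat.factorial (2 * i + 3))) := by
  have := unif_prob hP
  obtain ⟨q, rfl⟩ : ∃ q, s = 2 * q + 2 := by
    obtain ⟨k, hk⟩ := hse
    exact ⟨k - 1, by omega⟩
  have h1 : P.real (D t ((2 * q + 2 : ℕ) : ℤ) ∩ M2 t) = _ :=
    real_congr hP fun T hT => main_event hT t hse
  rw [unif_indep hP ((meas_below _ _).diff (meas_EL _))
    ((meas_U _ _).inter ((meas_below _ _).inter (meas_ER _))) (Iic (-1)) ?_ ?_,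
    P_left hP ht, J_closed hP ht q] at h1
  · rw [show (2 * q + 2) / 2 - 1 = q by omega]
    rw [Measure.real] at h1
    rw [h1]
    ring
  · exact (dep_below _ _ (by simp)).diff (dep_EL _)
  · refine ((dep_U _ _).mono ?_).inter ((dep_below _ _ ?_).inter ((dep_ER _).mono ?_))
    · intro i hi; simp only [mem_Icc] at hi; simp only [mem_compl_iff, mem_Iic]; omega
    · simp only [mem_compl_iff, mem_Iic]; omega
    · intro i hi; simp only [mem_Ici] at hi; simp only [mem_compl_iff, mem_Iic]; omega
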